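/- Consider a scaling (K_{1,n}, …, K_{r,n}, P_n, α_n) such that Λ_1(n) = c_n · (log n)/n for every n, where c_n → c and 0 < c < 1. Then the probability that the random graph G(n; μ, K_n, P_n, α_n) is connected tends to 0 as n → ∞. -/

import Mathlib

open Filter Real

noncomputable section

namespace HetKey

/-- The set of ordered index pairs `x < y` (one Bernoulli coin per unordered pair). -/
abbrev Pairs (n : ℕ) : Type := {p : Fin n × Fin n // p.1 < p.2}

/-- A configuration of the randomness: the class of each vertex, the key ring of each
vertex (a subset of the key pool `{1,…,P}`), and the Bernoulli link coins. -/
abbrev Config (n r P : ℕ) : Type :=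
  (Fin n → Fin r) × (Fin n → Finset (Fin P)) × (Pairs n → Bool)

/-- Weight of a key ring under the uniform distribution on `k`-subsets of the pool. -/
def keyWeight (P k : ℕ) (s : Finset (Fin P)) : ℝ :=
  if s.card = k then ((P.choose k : ℝ))⁻¹ else 0

/-- Probability weight of a configuration: classes are i.i.d. with law `μ`, key rings are
(conditionally) uniform `K (class)`-subsets, link coins are i.i.d. Bernoulli(`α`). -/
def weight {n r P : ℕ} (μ : Fin r → ℝ) (K : Fin r → ℕ) (α : ℝ)
    (cfg : Config n r P) : ℝ :=
  (∏ x, μ (cfg.1 x) * keyWeight P (K (cfg.1 x)) (cfg.2.1 x)) *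
    ∏ p, (if cfg.2.2 p then α else 1 - α)

open scoped Classical in
/-- Probability of an event in `G(n; μ, K, P, α)`. -/
def Pr {n r P : ℕ} (μ : Fin r → ℝ) (K : Fin r → ℕ) (α : ℝ)
    (E : Config n r P → Prop) : ℝ :=
  ∑ cfg, if E cfg then weight μ K α cfg else 0

/-- Expectation of a random variable on the configuration space. -/
def expect {n r P : ℕ} (μ : Fin r → ℝ) (K : Fin r → ℕ) (α : ℝ)
    (X : Config n r P → ℝ) : ℝ :=
  ∑ cfg, weight μ K α cfg * X cfg

/-- The Bernoulli coin attached to the unordered pair `{x, y}`. -/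
def coin {n : ℕ} (b : Pairs n → Bool) (x y : Fin n) : Bool :=
  if h : x < y then b ⟨(x, y), h⟩
  else if h' : y < x then b ⟨(y, x), h'⟩
  else false

/-- Adjacency in `G(n; μ, K, P, α)`: distinct vertices, intersecting key rings, and an
operational (non-failed) link. -/
def adj {n r P : ℕ} (cfg : Config n r P) (x y : Fin n) : Prop :=
  x ≠ y ∧ (cfg.2.1 x ∩ cfg.2.1 y).Nonempty ∧ coin cfg.2.2 x y = true

/-- A vertex is isolated if it has no neighbours. -/
def isolated {n r P : ℕ} (cfg : Config n r P) (x : Fin n) : Prop :=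
  ∀ y, ¬ adj cfg x y

/-- Connectivity: every pair of vertices is joined by a path. -/
def conn {n r P : ℕ} (cfg : Config n r P) : Prop :=
  ∀ x y : Fin n, Relation.ReflTransGen (adj cfg) x y

/-- `p_{ij}`: the probability that a uniform `K_i`-subset and an independent uniform
`K_j`-subset of a pool of size `P` intersect. -/
def pEdge (P Ki Kj : ℕ) : ℝ :=
  1 - ((P - Ki).choose Kj : ℝ) / (P.choose Kj : ℝ)

/-- `λ_i = Σ_j μ_j p_{ij}`. -/
def lam {r : ℕ} (μ : Fin r → ℝ) (K : Fin r → ℕ) (P : ℕ) (i : Fin r) : ℝ :=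
  ∑ j, μ j * pEdge P (K i) (K j)

/-- `Λ_i = α λ_i`. -/
def Lam {r : ℕ} (μ : Fin r → ℝ) (K : Fin r → ℕ) (P : ℕ) (α : ℝ) (i : Fin r) : ℝ :=
  α * lam μ K P i

end HetKey

open HetKey

namespace HetKey

lemma sum_pi_prod {ι κ : Type*} [Fintype ι] [DecidableEq ι] [Fintype κ] (f : ι → κ → ℝ) :
    ∑ b : ι → κ, ∏ i, f i (b i) = ∏ i, ∑ k, f i k := by
  rw [Finset.prod_univ_sum, Fintype.piFinset_univ]

/-- The probability that all coins indexed by `S` fail. -/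
lemma sum_coin_forall_false {ι : Type*} [Fintype ι] [DecidableEq ι] (α : ℝ) (S : Finset ι) :
    ∑ b : ι → Bool, (∏ p, if b p then α else 1 - α) * (if ∀ p ∈ S, b p = false then 1 else 0)
      = (1 - α) ^ S.card := by
  have key : ∀ b : ι → Bool,
      (∏ p, if b p then α else 1 - α) * (if ∀ p ∈ S, b p = false then (1 : ℝ) else 0)
        = ∏ p, (if b p then α else 1 - α) * (if p ∈ S ∧ b p then 0 else 1) := by
    intro b
    rw [Finset.prod_mul_distrib]
    congr 1
    split_ifs with h
    · refine (Finset.prod_eq_one fun p _ => ?_).symm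
      rw [if_neg]
      rintro ⟨hp, hb⟩
      simp [h p hp] at hb
    · push Not at h
      obtain ⟨p, hp, hb⟩ := h
      refine (Finset.prod_eq_zero (Finset.mem_univ p) ?_).symm
      simp_all
  simp_rw [key]
  rw [sum_pi_prod (fun p (c : Bool) => (if c then α else 1 - α) * (if p ∈ S ∧ c then 0 else 1))]
  have : ∀ p, ∑ c : Bool, (if c then α else 1 - α) * (if p ∈ S ∧ c then (0 : ℝ) else 1)
      = if p ∈ S then 1 - α else 1 := by
    intro p
    by_cases hp : p ∈ S <;> simp [hp]
  simp_rw [this]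
  simp

/-- The pairs joining `x` to a vertex satisfying `J`. -/
def star {n : ℕ} (x : Fin n) (J : Fin n → Prop) [DecidablePred J] : Finset (Pairs n) :=
  Finset.univ.filter fun p => (p.1.1 = x ∧ J p.1.2) ∨ (p.1.2 = x ∧ J p.1.1)

lemma card_star {n : ℕ} (x : Fin n) (J : Fin n → Prop) [DecidablePred J] :
    (star x J).card = (Finset.univ.filter fun z => z ≠ x ∧ J z).card := by
  symm
  refine Finset.card_bij
    (fun z hz => if h : x < z then ⟨(x, z), h⟩ else
      ⟨(z, x), lt_of_le_of_ne (not_lt.1 h) (Finset.mem_filter.1 hz).2.1⟩) ?_ ?_ ?_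
  · intro z hz
    have hz' := (Finset.mem_filter.1 hz).2
    by_cases h : x < z <;> simp [star, h, hz'.2]
  · intro a ha b hb hab
    have ha' := (Finset.mem_filter.1 ha).2
    have hb' := (Finset.mem_filter.1 hb).2
    by_cases h : x < a <;> by_cases h' : x < b <;> simp [h, h'] at hab
    · exact hab
    · exact absurd hab.1.symm hb'.1
    · exact absurd hab.1 ha'.1
    · exact hab
  · rintro ⟨⟨a, b⟩, hab⟩ hp
    simp only [star, Finset.mem_filter, Finset.mem_univ, true_and] at hp
    rcases hp with ⟨rfl, hJ⟩ | ⟨rfl, hJ⟩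
    · exact ⟨b, by simp [hJ, (ne_of_lt hab).symm], by simp [show a < b from hab]⟩
    · refine ⟨a, by simp [hJ, ne_of_lt hab], ?_⟩
      have : ¬ b < a := not_lt.2 (le_of_lt hab)
      simp [this]

lemma disjoint_star {n : ℕ} {x y : Fin n} (hxy : x ≠ y) (J J' : Fin n → Prop)
    [DecidablePred J] [DecidablePred J'] (hJ : ¬ J y) :
    Disjoint (star x J) (star y J') := by
  rw [Finset.disjoint_left]
  rintro ⟨⟨a, b⟩, hab⟩ h1 h2
  simp only [star, Finset.mem_filter, Finset.mem_univ, true_and] at h1 h2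
  rcases h1 with ⟨rfl, h1⟩ | ⟨rfl, h1⟩ <;> rcases h2 with ⟨rfl, h2⟩ | ⟨rfl, h2⟩ <;>
    first | exact hxy rfl | exact hJ h1

lemma isolated_iff {n r P : ℕ} (cfg : Config n r P) (x : Fin n) :
    isolated cfg x ↔
      ∀ p ∈ star x (fun z => (cfg.2.1 x ∩ cfg.2.1 z).Nonempty), cfg.2.2 p = false := by
  constructor
  · rintro h ⟨⟨a, b⟩, hab⟩ hp
    have hab' : a < b := hab
    simp only [star, Finset.mem_filter, Finset.mem_univ, true_and] at hp
    by_contra hc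
    rw [Bool.not_eq_false] at hc
    rcases hp with ⟨rfl, hJ⟩ | ⟨rfl, hJ⟩
    · exact h b ⟨hab'.ne, hJ, by simp [coin, hab', hc]⟩
    · exact h a ⟨hab'.ne', hJ, by simp [coin, hab', hab'.le, hc]⟩
  · rintro h y ⟨hne, hJ, hc⟩
    rcases lt_or_gt_of_ne hne with hlt | hlt
    · have := h ⟨(x, y), hlt⟩ (by simp [star, hJ])
      simp [coin, hlt, this] at hc
    · have := h ⟨(y, x), hlt⟩ (by simp [star, hJ])
      simp [coin, hlt, not_lt.2 hlt.le, this] at hc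

lemma not_isolated_of_conn {n r P : ℕ} (hn : 2 ≤ n) {cfg : Config n r P} (h : conn cfg)
    (x : Fin n) : ¬ isolated cfg x := by
  intro hx
  have : Nontrivial (Fin n) := Fin.nontrivial_iff_two_le.2 hn
  obtain ⟨y, hy⟩ := exists_ne x
  rcases Relation.ReflTransGen.cases_head (h x y) with h | ⟨z, hz, _⟩
  · exact hy h.symm
  · exact hx z hz

/-- Conditioning on the label of one vertex. -/
lemma sum_labels_one {W : Type*} [Fintype W] [DecidableEq W] {n : ℕ} (x : Fin n)
    (ν φ : W → ℝ) (h : W → W → ℝ) :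
    ∑ w : Fin n → W, (∏ v, ν (w v)) * (φ (w x) * ∏ z, if z = x then 1 else h (w x) (w z))
      = ∑ a, ν a * φ a * (∑ b, ν b * h a b) ^ (n - 1) := by
  have key : ∀ w : Fin n → W,
      (∏ v, ν (w v)) * (φ (w x) * ∏ z, if z = x then 1 else h (w x) (w z))
      = ∑ a, ∏ v, ν (w v) * (if v = x then (if w v = a then φ a else 0) else h a (w v)) := by
    intro w
    rw [Finset.sum_eq_single (w x)]
    · rw [Finset.prod_mul_distrib]
      congr 1
      rw [Fintype.prod_eq_mul_prod_compl x, Fintype.prod_eq_mul_prod_compl x]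
      simp only [if_true, one_mul]
      congr 1
      refine Finset.prod_congr rfl fun z hz => ?_
      have : z ≠ x := by simpa using hz
      simp [this]
    · intro a _ ha
      exact Finset.prod_eq_zero (Finset.mem_univ x) (by simp [ha.symm])
    · simp
  simp_rw [key]
  rw [Finset.sum_comm]
  refine Finset.sum_congr rfl fun a _ => ?_
  rw [sum_pi_prod (fun v c => ν c * (if v = x then (if c = a then φ a else 0) else h a c)),
    Fintype.prod_eq_mul_prod_compl x]
  congr 1
  · simp
  · rw [Finset.prod_congr rfl (g := fun _ => ∑ b, ν b * h a b), Finset.prod_const,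
      Finset.card_compl]
    · simp
    · intro z hz
      have : z ≠ x := by simpa using hz
      simp [this]

/-- Conditioning on the labels of two vertices. -/
lemma sum_labels_two {W : Type*} [Fintype W] [DecidableEq W] {n : ℕ} {x y : Fin n} (hxy : x ≠ y)
    (ν φ : W → ℝ) (h : W → W → ℝ) :
    ∑ w : Fin n → W, (∏ v, ν (w v)) * (φ (w x) * φ (w y) *
        ∏ z, if z = x ∨ z = y then 1 else h (w x) (w z) * h (w y) (w z))
      = ∑ a, ∑ a', ν a * φ a * (ν a' * φ a') * (∑ b, ν b * (h a b * h a' b)) ^ (n - 2) := by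
  have split : ∀ f : Fin n → ℝ, ∏ v, f v = f x * (f y * ∏ v ∈ {x, y}ᶜ, f v) := by
    intro f
    rw [← Finset.prod_mul_prod_compl {x, y}, Finset.prod_pair hxy, mul_assoc]
  have key : ∀ w : Fin n → W,
      (∏ v, ν (w v)) * (φ (w x) * φ (w y) *
        ∏ z, if z = x ∨ z = y then 1 else h (w x) (w z) * h (w y) (w z))
      = ∑ a, ∑ a', ∏ v, ν (w v) * (if v = x then (if w v = a then φ a else 0) else
          if v = y then (if w v = a' then φ a' else 0) else h a (w v) * h a' (w v)) := by
    intro w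
    rw [Finset.sum_eq_single (w x), Finset.sum_eq_single (w y)]
    · rw [Finset.prod_mul_distrib]
      congr 1
      rw [split, split]
      simp only [if_true, true_or, or_true, one_mul, hxy.symm, if_false, mul_assoc]
      congr 2
      refine Finset.prod_congr rfl fun z hz => ?_
      have : z ≠ x ∧ z ≠ y := by simpa using hz
      simp [this]
    · intro a _ ha
      exact Finset.prod_eq_zero (Finset.mem_univ y) (by simp [ha.symm, hxy.symm])
    · simp
    · intro a _ ha
      refine Finset.sum_eq_zero fun a' _ => ?_
      exact Finset.prod_eq_zero (Finset.mem_univ x) (by simp [ha.symm])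
    · simp
  simp_rw [key]
  rw [Finset.sum_comm]
  refine Finset.sum_congr rfl fun a _ => ?_
  rw [Finset.sum_comm]
  refine Finset.sum_congr rfl fun a' _ => ?_
  rw [sum_pi_prod (fun v c => ν c * (if v = x then (if c = a then φ a else 0) else
          if v = y then (if c = a' then φ a' else 0) else h a c * h a' c)), split, ← mul_assoc]
  congr 1
  · simp [hxy.symm]
  · rw [Finset.prod_congr rfl (g := fun _ => ∑ b, ν b * (h a b * h a' b)), Finset.prod_const,
      Finset.card_compl, Finset.card_pair hxy]
    · simp
    · intro z hz
      have : z ≠ x ∧ z ≠ y := by simpa using hz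
      simp [this]

/-- The joint law of the class and the key ring of a vertex. -/
def labelWeight {r : ℕ} (P : ℕ) (μ : Fin r → ℝ) (K : Fin r → ℕ)
    (a : Fin r × Finset (Fin P)) : ℝ :=
  μ a.1 * keyWeight P (K a.1) a.2

/-- The indicator that two key rings intersect. -/
def meet {r P : ℕ} (a b : Fin r × Finset (Fin P)) : ℝ :=
  if (a.2 ∩ b.2).Nonempty then 1 else 0

lemma meet_comm {r P : ℕ} (a b : Fin r × Finset (Fin P)) : meet a b = meet b a := by
  simp [meet, Finset.inter_comm]

lemma meet_nonneg {r P : ℕ} (a b : Fin r × Finset (Fin P)) : 0 ≤ meet a b := by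
  unfold meet; split_ifs <;> norm_num

lemma meet_le_one {r P : ℕ} (a b : Fin r × Finset (Fin P)) : meet a b ≤ 1 := by
  unfold meet; split_ifs <;> norm_num

lemma keyWeight_nonneg (P k : ℕ) (s : Finset (Fin P)) : 0 ≤ keyWeight P k s := by
  unfold keyWeight; split_ifs <;> positivity

lemma expect_eq_sum_labels {n r P : ℕ} (μ : Fin r → ℝ) (K : Fin r → ℕ) (α : ℝ)
    (X : Config n r P → ℝ) :
    expect μ K α X = ∑ w : Fin n → Fin r × Finset (Fin P), (∏ v, labelWeight P μ K (w v)) *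
      ∑ b : Pairs n → Bool, (∏ p, if b p then α else 1 - α) *
        X (fun v => (w v).1, fun v => (w v).2, b) := by
  unfold expect weight labelWeight
  rw [Fintype.sum_prod_type]
  simp_rw [Fintype.sum_prod_type]
  rw [← Fintype.sum_prod_type' (f := fun (t : Fin n → Fin r) (k : Fin n → Finset (Fin P)) =>
    ∑ b : Pairs n → Bool, ((∏ v, μ (t v) * keyWeight P (K (t v)) (k v)) *
      ∏ p, if b p then α else 1 - α) * X (t, k, b))]
  refine (Fintype.sum_equiv (Equiv.arrowProdEquivProdArrow (Fin n) (fun _ => Fin r)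
    (fun _ => Finset (Fin P))) _ _ fun w => ?_).symm
  rw [Finset.mul_sum]
  refine Finset.sum_congr rfl fun b _ => ?_
  simp [Equiv.arrowProdEquivProdArrow, mul_assoc]

lemma pow_card_star {n : ℕ} (x : Fin n) (J : Fin n → Prop) [DecidablePred J] (q : ℝ) :
    q ^ (star x J).card = ∏ z, if z ≠ x ∧ J z then q else 1 := by
  rw [card_star, ← Finset.prod_const, Finset.prod_filter]

open scoped Classical in
/-- The indicator that `x` is an isolated vertex of class `i`. -/
def isoInd {n r P : ℕ} (i : Fin r) (x : Fin n) (cfg : Config n r P) : ℝ :=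
  if cfg.1 x = i ∧ isolated cfg x then 1 else 0

lemma expect_isoInd {n r P : ℕ} (μ : Fin r → ℝ) (K : Fin r → ℕ) (α : ℝ) (i : Fin r)
    (x : Fin n) :
    expect (P := P) μ K α (isoInd i x) =
      ∑ a, labelWeight P μ K a * (if a.1 = i then 1 else 0) *
        (∑ b, labelWeight P μ K b * (1 - α * meet a b)) ^ (n - 1) := by
  rw [expect_eq_sum_labels, ← sum_labels_one x (labelWeight P μ K)
    (fun a => if a.1 = i then 1 else 0) (fun a b => 1 - α * meet a b)]
  refine Finset.sum_congr rfl fun w _ => ?_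
  congr 1
  set J : Fin n → Prop := fun z => ((w x).2 ∩ (w z).2).Nonempty with hJ
  have h1 : ∀ b : Pairs n → Bool,
      isoInd (P := P) i x (fun v => (w v).1, fun v => (w v).2, b) =
        (if (w x).1 = i then 1 else 0) * (if ∀ p ∈ star x J, b p = false then 1 else 0) := by
    intro b
    unfold isoInd
    rw [isolated_iff]
    rw [ite_zero_mul_ite_zero, mul_one]
    split_ifs <;> rfl
  simp_rw [h1, mul_left_comm _ (if (w x).1 = i then (1 : ℝ) else 0)]
  rw [← Finset.mul_sum, sum_coin_forall_false, pow_card_star]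
  congr 1
  refine Finset.prod_congr rfl fun z _ => ?_
  by_cases hz : z = x <;> by_cases hz' : ((w x).2 ∩ (w z).2).Nonempty <;>
    simp [hz, hz', meet, hJ]

lemma expect_isoInd_mul_le {n r P : ℕ} {μ : Fin r → ℝ} (hμ : ∀ i, 0 ≤ μ i) (K : Fin r → ℕ)
    {α : ℝ} (hα0 : 0 ≤ α) (hα1 : α ≤ 1) (i : Fin r) {x y : Fin n} (hxy : x ≠ y) :
    expect (P := P) μ K α (fun cfg => isoInd i x cfg * isoInd i y cfg) ≤
      ∑ a, ∑ a', labelWeight P μ K a * (if a.1 = i then 1 else 0) *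
        (labelWeight P μ K a' * (if a'.1 = i then 1 else 0)) *
        (∑ b, labelWeight P μ K b * ((1 - α * meet a b) * (1 - α * meet a' b))) ^ (n - 2) := by
  rw [expect_eq_sum_labels, ← sum_labels_two hxy (labelWeight P μ K)
    (fun a => if a.1 = i then 1 else 0) (fun a b => 1 - α * meet a b)]
  refine Finset.sum_le_sum fun w _ => ?_
  refine mul_le_mul_of_nonneg_left ?_
    (Finset.prod_nonneg fun v _ => mul_nonneg (hμ _) (keyWeight_nonneg _ _ _))
  set J : Fin n → Prop := fun z => z ≠ y ∧ ((w x).2 ∩ (w z).2).Nonempty with hJ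
  set J' : Fin n → Prop := fun z => z ≠ x ∧ ((w y).2 ∩ (w z).2).Nonempty with hJ'
  have h1 : ∀ b : Pairs n → Bool,
      isoInd (P := P) i x (fun v => (w v).1, fun v => (w v).2, b) *
      isoInd (P := P) i y (fun v => (w v).1, fun v => (w v).2, b) ≤
        ((if (w x).1 = i then 1 else 0) * (if (w y).1 = i then 1 else 0)) *
          (if ∀ p ∈ star x J ∪ star y J', b p = false then 1 else 0) := by
    intro b
    unfold isoInd
    rw [isolated_iff, isolated_iff]
    by_cases hx : (w x).1 = i
    swap
    · simp [hx]
    by_cases hy : (w y).1 = i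
    swap
    · simp [hy]
    by_cases hp : ∀ p ∈ star x J ∪ star y J', b p = false
    · rw [if_pos hp]
      simp only [hx, hy, true_and, if_true, mul_one]
      split_ifs <;> norm_num
    · rw [if_neg hp, mul_zero]
      refine le_of_eq ?_
      rw [ite_zero_mul_ite_zero, if_neg]
      rintro ⟨⟨_, h1⟩, ⟨_, h2⟩⟩
      refine hp fun p hp => ?_
      rcases Finset.mem_union.1 hp with hp | hp
      · refine h1 p ?_
        simp only [star, Finset.mem_filter, Finset.mem_univ, true_and, hJ] at hp ⊢
        tauto
      · refine h2 p ?_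
        simp only [star, Finset.mem_filter, Finset.mem_univ, true_and, hJ'] at hp ⊢
        tauto
  calc _ ≤ ∑ b : Pairs n → Bool, (∏ p, if b p then α else 1 - α) *
        (((if (w x).1 = i then 1 else 0) * (if (w y).1 = i then 1 else 0)) *
          (if ∀ p ∈ star x J ∪ star y J', b p = false then 1 else 0)) := by
        refine Finset.sum_le_sum fun b _ => mul_le_mul_of_nonneg_left (h1 b) ?_
        refine Finset.prod_nonneg fun p _ => ?_
        split_ifs <;> linarith
    _ = _ := by
        simp_rw [mul_left_comm _ ((if (w x).1 = i then (1 : ℝ) else 0) * _)]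
        rw [← Finset.mul_sum, sum_coin_forall_false,
          Finset.card_union_of_disjoint (disjoint_star hxy J J' (by simp [hJ])), pow_add,
          pow_card_star, pow_card_star, ← Finset.prod_mul_distrib]
        congr 1
        refine Finset.prod_congr rfl fun z _ => ?_
        by_cases hz : z = x
        · simp [hz, hJ']
        by_cases hz2 : z = y
        · simp [hz2, hJ]
        by_cases h3 : ((w x).2 ∩ (w z).2).Nonempty <;>
          by_cases h4 : ((w y).2 ∩ (w z).2).Nonempty <;> simp [hz, hz2, h3, h4, meet, hJ, hJ']

lemma sum_keyWeight_mul {P k : ℕ} (Q : Finset (Fin P) → Prop) [DecidablePred Q] :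
    ∑ s, keyWeight P k s * (if Q s then 1 else 0) =
      ((Finset.univ.filter fun s : Finset (Fin P) => s.card = k ∧ Q s).card : ℝ) /
        (P.choose k : ℝ) := by
  have : ∀ s : Finset (Fin P), keyWeight P k s * (if Q s then 1 else 0) =
      if s.card = k ∧ Q s then ((P.choose k : ℝ))⁻¹ else 0 := by
    intro s
    rw [keyWeight, ite_zero_mul_ite_zero, mul_one]
  simp_rw [this]
  rw [← Finset.sum_filter, Finset.sum_const, nsmul_eq_mul, div_eq_mul_inv]

lemma sum_keyWeight {P k : ℕ} (hk : k ≤ P) : ∑ s, keyWeight P k s = 1 := by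
  have h := sum_keyWeight_mul (P := P) (k := k) (fun _ => True)
  simp only [if_true, mul_one, and_true] at h
  have hc : (P.choose k : ℝ) ≠ 0 := by exact_mod_cast (Nat.choose_pos hk).ne'
  have h2 : (Finset.univ.filter fun s : Finset (Fin P) => s.card = k) =
      Finset.powersetCard k Finset.univ := by
    ext s; simp [Finset.mem_powersetCard]
  rw [h, h2, Finset.card_powersetCard, Finset.card_univ, Fintype.card_fin, div_self hc]

lemma sum_keyWeight_meet {P k : ℕ} (hk : k ≤ P) (A : Finset (Fin P)) :
    ∑ s, keyWeight P k s * (if (A ∩ s).Nonempty then 1 else 0) = pEdge P A.card k := by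
  have h := sum_keyWeight_mul (P := P) (k := k) (fun s => ¬ (A ∩ s).Nonempty)
  have h2 : (Finset.univ.filter fun s : Finset (Fin P) => s.card = k ∧ ¬ (A ∩ s).Nonempty) =
      Finset.powersetCard k Aᶜ := by
    ext s
    simp only [Finset.mem_filter, Finset.mem_univ, true_and, Finset.mem_powersetCard,
      Finset.not_nonempty_iff_eq_empty, ← Finset.disjoint_iff_inter_eq_empty]
    rw [and_comm, disjoint_comm, ← le_compl_iff_disjoint_right]
  rw [h2, Finset.card_powersetCard, Finset.card_compl, Fintype.card_fin] at h
  rw [pEdge, ← h, eq_sub_iff_add_eq, ← Finset.sum_add_distrib]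
  refine Eq.trans ?_ (sum_keyWeight hk)
  refine Finset.sum_congr rfl fun s _ => ?_
  split_ifs <;> simp

lemma pEdge_nonneg {P a b : ℕ} : 0 ≤ pEdge P a b := by
  rw [pEdge, sub_nonneg]
  refine div_le_one_of_le₀ ?_ (by positivity)
  exact_mod_cast Nat.choose_le_choose b (Nat.sub_le P a)

lemma sum_keyWeight_mul_pEdge {P a b : ℕ} (ha : a ≤ P) :
    ∑ s, keyWeight P a s * pEdge P s.card b = pEdge P a b := by
  have : ∀ s : Finset (Fin P), keyWeight P a s * pEdge P s.card b =
      keyWeight P a s * pEdge P a b := by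
    intro s
    unfold keyWeight
    split_ifs with h
    · rw [h]
    · simp
  simp_rw [this]
  rw [← Finset.sum_mul, sum_keyWeight ha, one_mul]

lemma pEdge_comm {P a b : ℕ} (ha : a ≤ P) (hb : b ≤ P) : pEdge P a b = pEdge P b a := by
  rw [← sum_keyWeight_mul_pEdge ha, ← sum_keyWeight_mul_pEdge hb]
  simp_rw [← sum_keyWeight_meet hb, ← sum_keyWeight_meet ha, Finset.mul_sum]
  rw [Finset.sum_comm]
  refine Finset.sum_congr rfl fun s _ => Finset.sum_congr rfl fun t _ => ?_
  rw [Finset.inter_comm]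
  ring

section Labels

variable {r P : ℕ} {μ : Fin r → ℝ} {K : Fin r → ℕ}

lemma labelWeight_nonneg (hμ : ∀ i, 0 ≤ μ i) (a : Fin r × Finset (Fin P)) :
    0 ≤ labelWeight P μ K a :=
  mul_nonneg (hμ _) (keyWeight_nonneg _ _ _)

lemma card_of_labelWeight_ne_zero {a : Fin r × Finset (Fin P)}
    (h : labelWeight P μ K a ≠ 0) : a.2.card = K a.1 := by
  by_contra hc
  exact h (by simp [labelWeight, keyWeight, hc])

lemma sum_labelWeight (hμ : ∑ i, μ i = 1) (hK : ∀ i, K i ≤ P) :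
    ∑ a, labelWeight P μ K a = 1 := by
  rw [Fintype.sum_prod_type]
  simp only [labelWeight]
  simp_rw [← Finset.mul_sum, sum_keyWeight (hK _), mul_one, hμ]

lemma sum_labelWeight_class (hK : ∀ i, K i ≤ P) (i : Fin r) :
    ∑ a, labelWeight P μ K a * (if a.1 = i then 1 else 0) = μ i := by
  rw [Fintype.sum_prod_type, Finset.sum_eq_single i]
  · simp [labelWeight, ← Finset.mul_sum, sum_keyWeight (hK i)]
  · intro j _ hj
    simp [hj]
  · simp

lemma sum_labelWeight_meet (hK : ∀ i, K i ≤ P) {i : Fin r} {a : Fin r × Finset (Fin P)}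
    (ha : a.2.card = K i) : ∑ b, labelWeight P μ K b * meet a b = lam μ K P i := by
  rw [Fintype.sum_prod_type]
  simp only [labelWeight, meet, lam]
  simp_rw [mul_assoc, ← Finset.mul_sum, sum_keyWeight_meet (hK _), ha]

lemma pEdge_le_lam (hμ : ∀ i, 0 < μ i) (i j : Fin r) :
    pEdge P (K i) (K j) ≤ lam μ K P i * ∑ l, (μ l)⁻¹ := by
  have h1 : μ j * pEdge P (K i) (K j) ≤ lam μ K P i :=
    Finset.single_le_sum (f := fun j => μ j * pEdge P (K i) (K j))
      (fun l _ => mul_nonneg (hμ l).le pEdge_nonneg) (Finset.mem_univ j)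
  have h2 : (μ j)⁻¹ ≤ ∑ l, (μ l)⁻¹ :=
    Finset.single_le_sum (f := fun l => (μ l)⁻¹)
      (fun l _ => (inv_pos.2 (hμ l)).le) (Finset.mem_univ j)
  have h0 : 0 ≤ lam μ K P i := (mul_nonneg (hμ j).le pEdge_nonneg).trans h1
  calc pEdge P (K i) (K j) = (μ j * pEdge P (K i) (K j)) * (μ j)⁻¹ := by
        field_simp [(hμ j).ne']
    _ ≤ lam μ K P i * ∑ l, (μ l)⁻¹ :=
        mul_le_mul h1 h2 (inv_pos.2 (hμ j)).le h0

lemma sum_class_meet_le (hμ : ∀ i, 0 < μ i) (hK : ∀ i, K i ≤ P) (i : Fin r)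
    {b : Fin r × Finset (Fin P)} (hb : b.2.card = K b.1) :
    ∑ a, labelWeight P μ K a * (if a.1 = i then 1 else 0) * meet a b ≤
      μ i * (lam μ K P i * ∑ l, (μ l)⁻¹) := by
  have : ∑ a, labelWeight P μ K a * (if a.1 = i then 1 else 0) * meet a b =
      μ i * pEdge P (K i) (K b.1) := by
    rw [pEdge_comm (hK _) (hK _), ← hb, ← sum_keyWeight_meet (hK i), Fintype.sum_prod_type,
      Finset.sum_eq_single i, Finset.mul_sum]
    · refine Finset.sum_congr rfl fun s _ => ?_
      simp [labelWeight, meet, Finset.inter_comm]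
    · intro j _ hj
      simp [hj]
    · simp
  rw [this]
  exact mul_le_mul_of_nonneg_left (pEdge_le_lam hμ i b.1) (hμ i).le

lemma lam_nonneg (hμ : ∀ i, 0 ≤ μ i) (i : Fin r) : 0 ≤ lam μ K P i :=
  Finset.sum_nonneg fun j _ => mul_nonneg (hμ j) pEdge_nonneg

lemma expect_isoInd_eq {n : ℕ} (hμ1 : ∑ i, μ i = 1) (hK : ∀ i, K i ≤ P) (α : ℝ) (i : Fin r)
    (x : Fin n) :
    expect (P := P) μ K α (isoInd i x) = μ i * (1 - Lam μ K P α i) ^ (n - 1) := by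
  rw [expect_isoInd]
  conv_rhs => rw [← sum_labelWeight_class (μ := μ) hK i, Finset.sum_mul]
  refine Finset.sum_congr rfl fun a _ => ?_
  by_cases hi : a.1 = i
  swap
  · simp [hi]
  by_cases ha : labelWeight P μ K a = 0
  · simp [ha]
  have hc := card_of_labelWeight_ne_zero ha
  rw [hi] at hc
  have : ∑ b, labelWeight P μ K b * (1 - α * meet a b) = 1 - Lam μ K P α i := by
    simp_rw [mul_sub, mul_one, mul_left_comm _ α]
    rw [Finset.sum_sub_distrib, ← Finset.mul_sum, sum_labelWeight hμ1 hK,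
      sum_labelWeight_meet hK hc, Lam]
  rw [this]

lemma exp_le_one_add_mul_exp (x : ℝ) : Real.exp x ≤ 1 + x * Real.exp x := by
  have h1 := Real.add_one_le_exp (-x)
  have h2 : Real.exp (-x) * Real.exp x = 1 := by rw [← Real.exp_add]; simp
  nlinarith [Real.exp_pos x]

lemma expect_isoInd_mul_le_sq {n : ℕ} (hn : 2 ≤ n) (hμ : ∀ i, 0 < μ i) (hμ1 : ∑ i, μ i = 1)
    (hK : ∀ i, K i ≤ P) {α : ℝ} (hα0 : 0 ≤ α) (hα1 : α ≤ 1) (i : Fin r)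
    {L : ℝ} (hL : Lam μ K P α i = L) (hL1 : L < 1) {x y : Fin n} (hxy : x ≠ y) :
    expect (P := P) μ K α (fun cfg => isoInd i x cfg * isoInd i y cfg) ≤
      (μ i * (1 - L) ^ (n - 1)) ^ 2 * (((1 - L) ^ 2)⁻¹ *
        (1 + (n * L ^ 2 / (1 - L) ^ 2) * (∑ l, (μ l)⁻¹) ^ 2 *
          Real.exp (n * L / (1 - L) ^ 2))) := by
  have hμ' : ∀ i, 0 ≤ μ i := fun i => (hμ i).le
  refine (expect_isoInd_mul_le hμ' K hα0 hα1 i hxy).trans ?_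
  set ν := labelWeight P μ K with hν
  set ρ : Fin r × Finset (Fin P) → ℝ := fun a => ν a * (if a.1 = i then 1 else 0) with hρ
  set lm := lam μ K P i with hlm
  set S := ∑ l, (μ l)⁻¹ with hS
  set q : Fin r × Finset (Fin P) → Fin r × Finset (Fin P) → ℝ :=
    fun a a' => ∑ b, ν b * (meet a b * meet a' b) with hq
  have hL' : α * lm = L := hL
  have hlm0 : 0 ≤ lm := lam_nonneg hμ' i
  have hν0 : ∀ a, 0 ≤ ν a := labelWeight_nonneg hμ'
  have hρ0 : ∀ a, 0 ≤ ρ a := fun a => mul_nonneg (hν0 a) (by split_ifs <;> norm_num)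
  have hd : 0 < 1 - L := by linarith
  have hd2 : 0 < (1 - L) ^ 2 := by positivity
  set u : ℝ := n * α ^ 2 / (1 - L) ^ 2 with hu
  have hu0 : 0 ≤ u := by positivity
  have hq0 : ∀ a a', 0 ≤ q a a' := fun a a' => Finset.sum_nonneg fun b _ =>
    mul_nonneg (hν0 b) (mul_nonneg (meet_nonneg _ _) (meet_nonneg _ _))
  have hcard : ∀ a, ρ a ≠ 0 → a.2.card = K i := by
    intro a ha
    have hi : a.1 = i := by
      by_contra hi
      exact ha (by simp [hρ, hi])
    rw [← hi]
    exact card_of_labelWeight_ne_zero (left_ne_zero_of_mul ha)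
  have hqle : ∀ a a', ρ a ≠ 0 → q a a' ≤ lm := by
    intro a a' ha
    rw [hlm, ← sum_labelWeight_meet hK (hcard a ha)]
    refine Finset.sum_le_sum fun b _ => mul_le_mul_of_nonneg_left ?_ (hν0 b)
    exact mul_le_of_le_one_right (meet_nonneg _ _) (meet_le_one _ _)
  have hbase : ∀ a a', ρ a ≠ 0 → ρ a' ≠ 0 →
      ∑ b, ν b * ((1 - α * meet a b) * (1 - α * meet a' b)) = 1 - 2 * L + α ^ 2 * q a a' := by
    intro a a' ha ha'
    have h1 : ∀ b, ν b * ((1 - α * meet a b) * (1 - α * meet a' b)) =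
        ν b - α * (ν b * meet a b) - α * (ν b * meet a' b) +
          α ^ 2 * (ν b * (meet a b * meet a' b)) := fun b => by ring
    simp_rw [h1]
    rw [Finset.sum_add_distrib, Finset.sum_sub_distrib, Finset.sum_sub_distrib,
      ← Finset.mul_sum, ← Finset.mul_sum, ← Finset.mul_sum, sum_labelWeight hμ1 hK,
      sum_labelWeight_meet hK (hcard a ha), sum_labelWeight_meet hK (hcard a' ha'), ← hL']
    ring
  have hpow : ∀ a a', ρ a ≠ 0 → ρ a' ≠ 0 →
      (∑ b, ν b * ((1 - α * meet a b) * (1 - α * meet a' b))) ^ (n - 2) ≤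
        ((1 - L) ^ 2) ^ (n - 2) * (1 + u * q a a' * Real.exp (u * lm)) := by
    intro a a' ha ha'
    have hnn : 0 ≤ ∑ b, ν b * ((1 - α * meet a b) * (1 - α * meet a' b)) := by
      have hh : ∀ a b : Fin r × Finset (Fin P), 0 ≤ 1 - α * meet a b := fun a b => by
        have := mul_le_mul hα1 (meet_le_one a b) (meet_nonneg a b) zero_le_one
        linarith
      exact Finset.sum_nonneg fun b _ => mul_nonneg (hν0 b) (mul_nonneg (hh _ _) (hh _ _))
    have hle : ∑ b, ν b * ((1 - α * meet a b) * (1 - α * meet a' b)) ≤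
        (1 - L) ^ 2 * Real.exp (α ^ 2 * q a a' / (1 - L) ^ 2) := by
      rw [hbase a a' ha ha']
      have h1 := mul_le_mul_of_nonneg_left
        (Real.add_one_le_exp (α ^ 2 * q a a' / (1 - L) ^ 2)) hd2.le
      rw [mul_add, mul_div_cancel₀ _ hd2.ne'] at h1
      nlinarith [sq_nonneg L]
    refine (pow_le_pow_left₀ hnn hle _).trans ?_
    rw [mul_pow, ← Real.exp_nat_mul]
    refine mul_le_mul_of_nonneg_left ?_ (by positivity)
    have hexp : ((n - 2 : ℕ) : ℝ) * (α ^ 2 * q a a' / (1 - L) ^ 2) ≤ u * q a a' := by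
      have h1 : ((n - 2 : ℕ) : ℝ) ≤ n := by exact_mod_cast Nat.sub_le n 2
      have h2 : 0 ≤ α ^ 2 * q a a' / (1 - L) ^ 2 :=
        div_nonneg (mul_nonneg (sq_nonneg α) (hq0 a a')) hd2.le
      calc _ ≤ (n : ℝ) * (α ^ 2 * q a a' / (1 - L) ^ 2) := mul_le_mul_of_nonneg_right h1 h2
        _ = u * q a a' := by rw [hu]; ring
    refine (Real.exp_le_exp.2 hexp).trans ((exp_le_one_add_mul_exp _).trans ?_)
    have h3 : Real.exp (u * q a a') ≤ Real.exp (u * lm) :=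
      Real.exp_le_exp.2 (mul_le_mul_of_nonneg_left (hqle a a' ha) hu0)
    have h4 := mul_le_mul_of_nonneg_left h3 (mul_nonneg hu0 (hq0 a a'))
    linarith
  have hsumρ : ∑ a, ρ a = μ i := sum_labelWeight_class hK i
  have hsumq : ∑ a, ∑ a', ρ a * ρ a' * q a a' ≤ (μ i * (lm * S)) ^ 2 := by
    have h1 : ∑ a, ∑ a', ρ a * ρ a' * q a a' = ∑ b, ν b * (∑ a, ρ a * meet a b) ^ 2 := by
      simp_rw [hq, sq, Finset.sum_mul_sum, Finset.mul_sum]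
      rw [Finset.sum_comm' (t' := Finset.univ) (s' := fun _ => Finset.univ) (by simp)]
      conv_rhs => rw [Finset.sum_comm]
      rw [Finset.sum_comm]
      refine Finset.sum_congr rfl fun a _ => ?_
      conv_rhs => rw [Finset.sum_comm]
      refine Finset.sum_congr rfl fun a' _ => Finset.sum_congr rfl fun b _ => ?_
      ring
    rw [h1]
    calc _ ≤ ∑ b, ν b * (μ i * (lm * S)) ^ 2 := by
          refine Finset.sum_le_sum fun b _ => ?_
          by_cases hb : ν b = 0
          · simp [hb]
          refine mul_le_mul_of_nonneg_left ?_ (hν0 b)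
          exact pow_le_pow_left₀
            (Finset.sum_nonneg fun a _ => mul_nonneg (hρ0 a) (meet_nonneg _ _))
            (sum_class_meet_le hμ hK i (card_of_labelWeight_ne_zero hb)) 2
      _ = _ := by rw [← Finset.sum_mul, sum_labelWeight hμ1 hK, one_mul]
  calc _ ≤ ∑ a, ∑ a', ρ a * ρ a' *
        (((1 - L) ^ 2) ^ (n - 2) * (1 + u * q a a' * Real.exp (u * lm))) := by
        refine Finset.sum_le_sum fun a _ => Finset.sum_le_sum fun a' _ => ?_
        by_cases ha : ρ a = 0
        · exact le_of_eq ((mul_eq_zero_of_left (mul_eq_zero_of_left ha _) _).trans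
            (mul_eq_zero_of_left (mul_eq_zero_of_left ha _) _).symm)
        by_cases ha' : ρ a' = 0
        · exact le_of_eq ((mul_eq_zero_of_left (mul_eq_zero_of_right _ ha') _).trans
            (mul_eq_zero_of_left (mul_eq_zero_of_right _ ha') _).symm)
        exact mul_le_mul_of_nonneg_left (hpow a a' ha ha') (mul_nonneg (hρ0 a) (hρ0 a'))
    _ = ((1 - L) ^ 2) ^ (n - 2) * ((∑ a, ρ a) * (∑ a, ρ a) +
          u * Real.exp (u * lm) * ∑ a, ∑ a', ρ a * ρ a' * q a a') := by
        rw [Finset.sum_mul_sum, Finset.mul_sum, ← Finset.sum_add_distrib, Finset.mul_sum]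
        refine Finset.sum_congr rfl fun a _ => ?_
        rw [Finset.mul_sum, ← Finset.sum_add_distrib, Finset.mul_sum]
        refine Finset.sum_congr rfl fun a' _ => ?_
        ring
    _ ≤ ((1 - L) ^ 2) ^ (n - 2) * (μ i * μ i +
          u * Real.exp (u * lm) * (μ i * (lm * S)) ^ 2) := by
        rw [hsumρ]
        gcongr
    _ ≤ ((1 - L) ^ 2) ^ (n - 2) * (μ i * μ i +
          u * Real.exp (n * L / (1 - L) ^ 2) * (μ i * (lm * S)) ^ 2) := by
        have hulm : u * lm ≤ n * L / (1 - L) ^ 2 := by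
          rw [hu, div_mul_eq_mul_div]
          refine div_le_div_of_nonneg_right ?_ hd2.le
          rw [← hL', mul_assoc]
          refine mul_le_mul_of_nonneg_left ?_ (Nat.cast_nonneg n)
          nlinarith [mul_nonneg hα0 hlm0]
        gcongr
    _ = _ := by
        obtain ⟨m, rfl⟩ := Nat.exists_eq_add_of_le hn
        rw [show 2 + m - 2 = m by omega, show 2 + m - 1 = m + 1 by omega, hu, ← pow_mul, ← hL']
        rw [← hL'] at hd
        field_simp
        ring

end Labels

section SecondMoment

variable {n r P : ℕ} {μ : Fin r → ℝ} {K : Fin r → ℕ} {α : ℝ}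

lemma weight_nonneg (hμ : ∀ i, 0 ≤ μ i) (hα0 : 0 ≤ α) (hα1 : α ≤ 1) (cfg : Config n r P) :
    0 ≤ weight μ K α cfg := by
  refine mul_nonneg (Finset.prod_nonneg fun v _ => mul_nonneg (hμ _) (keyWeight_nonneg _ _ _))
    (Finset.prod_nonneg fun p _ => ?_)
  split_ifs <;> linarith

lemma sum_weight (hμ1 : ∑ i, μ i = 1) (hK : ∀ i, K i ≤ P) :
    ∑ cfg : Config n r P, weight μ K α cfg = 1 := by
  have h := expect_eq_sum_labels (n := n) (P := P) μ K α (fun _ => 1)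
  have h2 := sum_coin_forall_false (ι := Pairs n) α ∅
  simp only [Finset.notMem_empty, false_imp_iff, implies_true, if_true, mul_one,
    Finset.card_empty, pow_zero] at h2
  simp only [expect, mul_one, h2] at h
  rw [h, sum_pi_prod (fun _ : Fin n => labelWeight P μ K), sum_labelWeight hμ1 hK]
  simp

lemma Pr_nonneg (hμ : ∀ i, 0 ≤ μ i) (hα0 : 0 ≤ α) (hα1 : α ≤ 1) (E : Config n r P → Prop) :
    0 ≤ Pr μ K α E := by
  refine Finset.sum_nonneg fun cfg _ => ?_
  split_ifs
  · exact weight_nonneg hμ hα0 hα1 cfg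
  · exact le_rfl

lemma isoInd_mul_self (i : Fin r) (x : Fin n) (cfg : Config n r P) :
    isoInd i x cfg * isoInd i x cfg = isoInd i x cfg := by
  unfold isoInd; split_ifs <;> simp

/-- Chebyshev's inequality for the number of isolated vertices of class `i`. -/
lemma Pr_conn_le (hn : 2 ≤ n) (hμ : ∀ i, 0 ≤ μ i) (hμ1 : ∑ i, μ i = 1) (hK : ∀ i, K i ≤ P)
    (hα0 : 0 ≤ α) (hα1 : α ≤ 1) (i : Fin r) {M D : ℝ} (hM : 0 < M)
    (h1 : ∀ x, expect (n := n) (P := P) μ K α (isoInd i x) = M)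
    (h2 : ∀ x y, x ≠ y →
      expect (n := n) (P := P) μ K α (fun cfg => isoInd i x cfg * isoInd i y cfg) ≤ M ^ 2 * D)
    (hD : 0 ≤ D) :
    Pr (n := n) (P := P) μ K α (fun cfg => conn cfg) ≤ 1 / (n * M) + D - 1 := by
  have hn0 : (0 : ℝ) < n := by exact_mod_cast (by omega : 0 < n)
  set X : Config n r P → ℝ := fun cfg => ∑ x, isoInd i x cfg with hX
  have hEX : ∑ cfg, weight μ K α cfg * X cfg = n * M := by
    simp_rw [hX, Finset.mul_sum]
    rw [Finset.sum_comm]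
    have : ∀ x, ∑ cfg, weight (P := P) μ K α cfg * isoInd i x cfg = M := h1
    simp [this]
  have hEX2 : ∑ cfg, weight μ K α cfg * (X cfg) ^ 2 ≤ n * M + n ^ 2 * (M ^ 2 * D) := by
    have e1 : ∑ cfg, weight μ K α cfg * (X cfg) ^ 2 = ∑ x, ∑ y,
        expect (n := n) (P := P) μ K α (fun cfg => isoInd i x cfg * isoInd i y cfg) := by
      simp_rw [hX, sq, Finset.sum_mul_sum, Finset.mul_sum]
      rw [Finset.sum_comm]
      refine Finset.sum_congr rfl fun x _ => ?_
      rw [Finset.sum_comm]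
      rfl
    have e2 : ∀ x y, expect (n := n) (P := P) μ K α
        (fun cfg => isoInd i x cfg * isoInd i y cfg) ≤ (if x = y then M else 0) + M ^ 2 * D := by
      intro x y
      by_cases hxy : x = y
      · subst hxy
        simp_rw [isoInd_mul_self, if_true]
        rw [h1 x]
        have : 0 ≤ M ^ 2 * D := by positivity
        linarith
      · simpa [hxy] using h2 x y hxy
    rw [e1]
    refine (Finset.sum_le_sum fun x _ => Finset.sum_le_sum fun y _ => e2 x y).trans
      (le_of_eq ?_)
    simp [Finset.sum_add_distrib]
    ring
  have hvar : Pr (n := n) (P := P) μ K α (fun cfg => conn cfg) * (n * M) ^ 2 ≤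
      ∑ cfg, weight μ K α cfg * (X cfg - n * M) ^ 2 := by
    unfold Pr
    rw [Finset.sum_mul]
    refine Finset.sum_le_sum fun cfg _ => ?_
    have hw := weight_nonneg (K := K) hμ hα0 hα1 cfg
    split_ifs with hc
    · have : X cfg = 0 := Finset.sum_eq_zero fun x _ => by
        simp [isoInd, not_isolated_of_conn hn hc x]
      rw [this]
      exact le_of_eq (by ring)
    · rw [zero_mul]
      positivity
  have hexp : ∑ cfg, weight μ K α cfg * (X cfg - n * M) ^ 2 =
      ∑ cfg, weight μ K α cfg * (X cfg) ^ 2 - (n * M) ^ 2 := by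
    have : ∀ cfg, weight μ K α cfg * (X cfg - n * M) ^ 2 = weight μ K α cfg * (X cfg) ^ 2 -
        2 * (n * M) * (weight μ K α cfg * X cfg) + (n * M) ^ 2 * weight μ K α cfg :=
      fun cfg => by ring
    simp_rw [this]
    rw [Finset.sum_add_distrib, Finset.sum_sub_distrib, ← Finset.mul_sum, ← Finset.mul_sum, hEX,
      sum_weight hμ1 hK]
    ring
  have hpos : 0 < ((n : ℝ) * M) ^ 2 := by positivity
  have hfin : Pr (n := n) (P := P) μ K α (fun cfg => conn cfg) ≤
      (n * M + n ^ 2 * (M ^ 2 * D) - (n * M) ^ 2) / (n * M) ^ 2 := by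
    rw [le_div_iff₀ hpos]
    linarith
  refine hfin.trans (le_of_eq ?_)
  field_simp

lemma Pr_conn_le_of_Lam (hn : 2 ≤ n) (hμ : ∀ i, 0 < μ i) (hμ1 : ∑ i, μ i = 1)
    (hK : ∀ i, K i ≤ P) (hα0 : 0 ≤ α) (hα1 : α ≤ 1) (i : Fin r) {L : ℝ}
    (hL : Lam μ K P α i = L) (hL1 : L < 1) :
    Pr (n := n) (P := P) μ K α (fun cfg => conn cfg) ≤
      1 / (n * (μ i * (1 - L) ^ (n - 1))) + ((1 - L) ^ 2)⁻¹ *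
        (1 + (n * L ^ 2 / (1 - L) ^ 2) * (∑ l, (μ l)⁻¹) ^ 2 *
          Real.exp (n * L / (1 - L) ^ 2)) - 1 := by
  have hd : 0 < 1 - L := by linarith
  refine Pr_conn_le hn (fun j => (hμ j).le) hμ1 hK hα0 hα1 i
    (mul_pos (hμ i) (pow_pos hd _)) (fun x => ?_) (fun x y hxy => ?_) (by positivity)
  · rw [expect_isoInd_eq hμ1 hK, hL]
  · exact expect_isoInd_mul_le_sq hn hμ hμ1 hK hα0 hα1 i hL hL1 hxy

end SecondMoment

lemma exp_neg_div_le {L : ℝ} (hL : L < 1) : Real.exp (-(L / (1 - L))) ≤ 1 - L := by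
  have hd : 0 < 1 - L := by linarith
  rw [Real.exp_neg, inv_le_comm₀ (Real.exp_pos _) hd]
  refine le_trans (le_of_eq ?_) (Real.add_one_le_exp _)
  field_simp
  ring

lemma tendsto_log_sq_mul_rpow {c : ℝ} (hc : c < 1) :
    Tendsto (fun n : ℕ => Real.log n ^ 2 * (n : ℝ) ^ (c - 1)) atTop (nhds 0) := by
  have h := (isLittleO_log_rpow_rpow_atTop 2 (sub_pos.2 hc)).tendsto_div_nhds_zero
  refine (h.comp tendsto_natCast_atTop_atTop).congr fun n => ?_
  simp only [Function.comp, Real.rpow_two]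
  rw [div_eq_mul_inv, ← Real.rpow_neg (Nat.cast_nonneg n), neg_sub]

lemma tendsto_conn_bound {m S c : ℝ} (hm : 0 < m) {cn : ℕ → ℝ}
    (hcn : Tendsto cn atTop (nhds c)) (hc0 : 0 < c) (hc1 : c < 1) {L : ℕ → ℝ}
    (hL : ∀ n, 2 ≤ n → L n = cn n * Real.log n / n) :
    Tendsto L atTop (nhds 0) ∧
    Tendsto (fun n : ℕ => 1 / (n * (m * (1 - L n) ^ (n - 1))) + ((1 - L n) ^ 2)⁻¹ *
        (1 + (n * L n ^ 2 / (1 - L n) ^ 2) * S ^ 2 *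
          Real.exp (n * L n / (1 - L n) ^ 2)) - 1) atTop (nhds 0) := by
  have hlog : Tendsto (fun n : ℕ => Real.log n / n) atTop (nhds 0) :=
    Real.isLittleO_log_id_atTop.tendsto_div_nhds_zero.comp tendsto_natCast_atTop_atTop
  have hL0 : Tendsto L atTop (nhds 0) := by
    have h := hcn.mul hlog
    rw [mul_zero] at h
    refine h.congr' ?_
    filter_upwards [eventually_ge_atTop 2] with n hn
    rw [hL n hn, mul_div_assoc]
  refine ⟨hL0, ?_⟩
  obtain ⟨d, hcd, hd1⟩ := exists_between hc1
  have h1L : Tendsto (fun n => 1 - L n) atTop (nhds 1) := by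
    simpa using tendsto_const_nhds.sub hL0
  have h1L2 : Tendsto (fun n => (1 - L n) ^ 2) atTop (nhds 1) := by simpa using h1L.pow 2
  have hr1 : ∀ᶠ n in atTop, cn n / (1 - L n) < d := by
    have := hcn.div h1L one_ne_zero
    rw [div_one] at this
    exact this.eventually_lt_const hcd
  have hr2 : ∀ᶠ n in atTop, cn n / (1 - L n) ^ 2 < d := by
    have := hcn.div h1L2 one_ne_zero
    rw [div_one] at this
    exact this.eventually_lt_const hcd
  have hLlt : ∀ᶠ n in atTop, L n < 1 := hL0.eventually_lt_const one_pos
  have hcpos : ∀ᶠ n in atTop, 0 < cn n := hcn.eventually_const_lt hc0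
  have hA : Tendsto (fun n : ℕ => 1 / (n * (m * (1 - L n) ^ (n - 1)))) atTop (nhds 0) := by
    have hpow : Tendsto (fun n : ℕ => m⁻¹ * (n : ℝ) ^ (d - 1)) atTop (nhds 0) := by
      have h := (tendsto_rpow_neg_atTop (sub_pos.2 hd1)).comp tendsto_natCast_atTop_atTop
      have h' := h.const_mul m⁻¹
      rw [mul_zero] at h'
      refine h'.congr fun n => ?_
      simp [Function.comp]
    refine squeeze_zero' ?_ ?_ hpow
    · filter_upwards [hLlt] with n h
      have : 0 < 1 - L n := by linarith
      positivity
    · filter_upwards [hLlt, hr1, hcpos, eventually_ge_atTop 2] with n h hr hc hn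
      have hp : 0 < 1 - L n := by linarith
      have hn0 : (0 : ℝ) < n := by exact_mod_cast (by omega : 0 < n)
      have hlogn : 0 ≤ Real.log n := Real.log_natCast_nonneg n
      have hLn : 0 ≤ L n := by
        rw [hL n hn]
        positivity
      have hlow : (n : ℝ) ^ (-d) ≤ (1 - L n) ^ (n - 1) := by
        calc (n : ℝ) ^ (-d) = Real.exp (-(d * Real.log n)) := by
              rw [Real.rpow_def_of_pos hn0]; ring_nf
          _ ≤ Real.exp (n * (-(L n / (1 - L n)))) := by
              refine Real.exp_le_exp.2 ?_
              have e : (n : ℝ) * (-(L n / (1 - L n))) = -(cn n / (1 - L n) * Real.log n) := by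
                have : (n : ℝ) * L n = cn n * Real.log n := by
                  rw [hL n hn]; field_simp
                rw [mul_neg, ← mul_div_assoc, this]
                ring
              rw [e]
              exact neg_le_neg (mul_le_mul_of_nonneg_right hr.le hlogn)
          _ = Real.exp (-(L n / (1 - L n))) ^ n := Real.exp_nat_mul _ _
          _ ≤ (1 - L n) ^ n := pow_le_pow_left₀ (Real.exp_pos _).le (exp_neg_div_le h) _
          _ ≤ (1 - L n) ^ (n - 1) :=
              pow_le_pow_of_le_one hp.le (by linarith) (Nat.sub_le _ _)
      calc 1 / (n * (m * (1 - L n) ^ (n - 1))) ≤ 1 / (n * (m * (n : ℝ) ^ (-d))) := by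
            gcongr
        _ = m⁻¹ * (n : ℝ) ^ (d - 1) := by
            rw [Real.rpow_neg hn0.le, Real.rpow_sub_one hn0.ne']
            have := (Real.rpow_pos_of_pos hn0 d).ne'
            field_simp
  have hB : Tendsto (fun n : ℕ => (n * L n ^ 2 / (1 - L n) ^ 2) * S ^ 2 *
      Real.exp (n * L n / (1 - L n) ^ 2)) atTop (nhds 0) := by
    have hbd : Tendsto (fun n : ℕ => (cn n ^ 2 / (1 - L n) ^ 2 * S ^ 2) *
        (Real.log n ^ 2 * (n : ℝ) ^ (d - 1))) atTop (nhds 0) := by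
      have h := (((hcn.pow 2).div h1L2 one_ne_zero).mul_const (S ^ 2)).mul
        (tendsto_log_sq_mul_rpow hd1)
      simpa using h
    refine squeeze_zero' ?_ ?_ hbd
    · filter_upwards with n
      positivity
    · filter_upwards [hr2, eventually_ge_atTop 2] with n hr hn
      have hn0 : (0 : ℝ) < n := by exact_mod_cast (by omega : 0 < n)
      have hlogn : 0 ≤ Real.log n := Real.log_natCast_nonneg n
      have hexp : Real.exp (n * L n / (1 - L n) ^ 2) ≤ (n : ℝ) ^ d := by
        rw [Real.rpow_def_of_pos hn0]
        refine Real.exp_le_exp.2 ?_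
        have : (n : ℝ) * L n = cn n * Real.log n := by
          rw [hL n hn]; field_simp
        rw [this, mul_div_right_comm, mul_comm (Real.log n)]
        exact mul_le_mul_of_nonneg_right hr.le hlogn
      calc _ ≤ (n * L n ^ 2 / (1 - L n) ^ 2) * S ^ 2 * (n : ℝ) ^ d := by gcongr
        _ = _ := by
          have : (n : ℝ) * L n ^ 2 = cn n ^ 2 * Real.log n ^ 2 / n := by
            rw [hL n hn]; field_simp
          rw [this, Real.rpow_sub_one hn0.ne']
          ring
  have h := (hA.add ((h1L2.inv₀ one_ne_zero).mul (hB.const_add 1))).sub_const 1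
  simpa using h

end HetKey

/-- zero-law for connectivity: if `Λ_1(n) = c_n log n / n`
with `c_n → c` and `0 < c < 1`, then the probability that
`G(n; μ, K_n, P_n, α_n)` is connected tends to `0`. -/
theorem connectivity_zero_law
    (r : ℕ) (hr : 0 < r)
    (μ : Fin r → ℝ) (hμpos : ∀ i, 0 < μ i) (hμsum : ∑ i, μ i = 1)
    (K : ℕ → Fin r → ℕ) (Pn : ℕ → ℕ) (α : ℕ → ℝ)
    (hα0 : ∀ n, 0 < α n) (hα1 : ∀ n, α n < 1)
    (hK1 : ∀ n i, 1 ≤ K n i)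
    (hKmono : ∀ n, Monotone (K n))
    (hKP : ∀ n i, 2 * K n i ≤ Pn n)
    (cn : ℕ → ℝ) (c : ℝ)
    (hcn : Tendsto cn atTop (nhds c)) (hc0 : 0 < c) (hc1 : c < 1)
    (hΛ : ∀ n, 2 ≤ n →
      Lam μ (K n) (Pn n) (α n) ⟨0, hr⟩ = cn n * Real.log n / n) :
    Tendsto
      (fun n => Pr (n := n) (P := Pn n) μ (K n) (α n) (fun cfg => conn cfg))
      atTop (nhds 0) := by
  set i : Fin r := ⟨0, hr⟩
  obtain ⟨hL0, hlim⟩ := tendsto_conn_bound (S := ∑ l, (μ l)⁻¹) (hμpos i) hcn hc0 hc1 hΛ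
  refine squeeze_zero'
    (Eventually.of_forall fun n =>
      Pr_nonneg (fun j => (hμpos j).le) (hα0 n).le (hα1 n).le _) ?_ hlim
  filter_upwards [hL0.eventually_lt_const one_pos, eventually_ge_atTop 2] with n hL hn
  exact Pr_conn_le_of_Lam hn hμpos hμsum (fun j => by have := hKP n j; omega)
    (hα0 n).le (hα1 n).le i rfl hL
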